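/- Let 1 < β < 2, M ≥ 2 an integer, μ₀ > 0, K > 0 and ν_β > 0. Then the circulant preconditioner R = μ₀·I + K·ν_β·r(G_β) is symmetric positive definite, every eigenvalue λ of R satisfies μ₀ < λ < μ₀ + 2·K·ν_β·ĝ₀^{(β)}, and consequently the spectral (ℓ²-operator) norms satisfy ‖R⁻¹‖₂ < 1/μ₀ and ‖R‖₂ < μ₀ + 2·K·ν_β·ĝ₀^{(β)}. -/

import Mathlib

/-- Fractional centered difference coefficients `ĝ_k^{(β)}`. -/
noncomputable def ghat (β : ℝ) (k : ℤ) : ℝ :=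
  (-1 : ℝ) ^ k * Real.Gamma (β + 1) /
    (Real.Gamma (β / 2 - k + 1) * Real.Gamma (β / 2 + k + 1))

/-- The `(M−1)×(M−1)` symmetric Toeplitz matrix `G_β`. -/
noncomputable def Gmat (β : ℝ) (M : ℕ) : Matrix (Fin (M - 1)) (Fin (M - 1)) ℝ :=
  Matrix.of fun i j => ghat β ((i : ℤ) - (j : ℤ))

/-- First column of the circulant approximation `r(G_β)`. -/
noncomputable def rcol (β : ℝ) (M : ℕ) (k : ℕ) : ℝ :=
  if k = 0 then ghat β 0 else ghat β k + ghat β ((k : ℤ) - ((M : ℤ) - 1))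

/-- The `(M−1)×(M−1)` circulant matrix `r(G_β)`. -/
noncomputable def circG (β : ℝ) (M : ℕ) : Matrix (Fin (M - 1)) (Fin (M - 1)) ℝ :=
  Matrix.of fun i j => rcol β M ((((i : ℤ) - (j : ℤ)) % ((M : ℤ) - 1)).toNat)

/-- The constant `c_*^{(β)} = (2/β) r_β`. -/
noncomputable def cstar (β : ℝ) : ℝ :=
  (2 / β) * (Real.exp (-2) * ((4 - β) * (2 - β) * β) / ((6 + β) * (4 + β) * (2 + β)) *
    (Real.Gamma (β + 1) / (Real.Gamma (β / 2 + 1)) ^ 2) * (3 + β / 2) ^ (β + 1))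

/-- Grünwald coefficients `g_k^{(γ)}`. -/
noncomputable def gcoef (γ : ℝ) : ℕ → ℝ
  | 0 => 1
  | (k + 1) => (1 - (γ + 1) / (k + 1)) * gcoef γ k

/-- Weighted and shifted Grünwald coefficients `λ_k^{(γ)}`. -/
noncomputable def lamc (γ : ℝ) : ℕ → ℝ
  | 0 => 1 + γ / 2
  | (k + 1) => (1 + γ / 2) * gcoef γ (k + 1) - (γ / 2) * gcoef γ k

lemma ghat_succ (β : ℝ) (hβ1 : 1 < β) (hβ2 : β < 2) (k : ℕ) :
    ghat β ((k + 1 : ℕ) : ℤ) = ghat β (k : ℤ) * (k - β / 2) / (k + 1 + β / 2) := by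
  have hne : β / 2 - k ≠ 0 := by
    rcases Nat.eq_zero_or_pos k with h | h
    · subst h; simp; linarith
    · have : (1 : ℝ) ≤ k := by exact_mod_cast h
      intro h; linarith
  have hk : (0 : ℝ) ≤ k := Nat.cast_nonneg k
  have h2 : β / 2 + k + 1 ≠ 0 := by positivity
  have e1 : Real.Gamma (β / 2 - k + 1) = (β / 2 - k) * Real.Gamma (β / 2 - k) :=
    Real.Gamma_add_one hne
  have e2 : Real.Gamma (β / 2 + k + 1 + 1) = (β / 2 + k + 1) * Real.Gamma (β / 2 + k + 1) :=
    Real.Gamma_add_one h2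
  unfold ghat
  have a1 : β / 2 - (((k + 1 : ℕ) : ℤ) : ℝ) + 1 = β / 2 - k := by push_cast; ring
  have a2 : β / 2 + (((k + 1 : ℕ) : ℤ) : ℝ) + 1 = β / 2 + k + 1 + 1 := by push_cast; ring
  rw [a1, a2, e2]
  have a3 : (((k : ℕ) : ℤ) : ℝ) = k := by push_cast; rfl
  rw [a3, e1]
  have h3 : (k : ℝ) + 1 + β / 2 = β / 2 + k + 1 := by ring
  rw [h3, zpow_natCast, zpow_natCast, pow_succ]
  have h4 : (k : ℝ) - β / 2 = - (β / 2 - k) := by ring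
  rw [h4]
  have hz : (β / 2 - k) * (β / 2 - k)⁻¹ = 1 := mul_inv_cancel₀ hne
  simp only [div_eq_mul_inv, mul_inv] at hz ⊢
  linear_combination (-(-1 : ℝ) ^ k * Real.Gamma (β + 1) * (Real.Gamma (β * 2⁻¹ - k))⁻¹ *
    (Real.Gamma (β * 2⁻¹ + k + 1))⁻¹ * (β * 2⁻¹ + k + 1)⁻¹) * (1 - hz)

lemma ghat_neg (β : ℝ) (k : ℤ) : ghat β (-k) = ghat β k := by
  unfold ghat
  have : (-1 : ℝ) ^ (-k) = (-1) ^ k := by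
    rw [zpow_neg, ← inv_zpow]; norm_num
  rw [this]; push_cast
  rw [mul_comm (Real.Gamma (β / 2 - -(k : ℝ) + 1))]
  congr 4; ring

lemma ghat_zero_pos (β : ℝ) (hβ1 : 1 < β) : 0 < ghat β 0 := by
  unfold ghat
  have h1 : 0 < Real.Gamma (β + 1) := Real.Gamma_pos_of_pos (by linarith)
  have h2 : 0 < Real.Gamma (β / 2 + 1) := Real.Gamma_pos_of_pos (by linarith)
  simp only [Int.cast_zero, sub_zero, add_zero, zpow_zero, one_mul]
  positivity

lemma ghat_pos_neg (β : ℝ) (hβ1 : 1 < β) (hβ2 : β < 2) (k : ℕ) :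
    ghat β ((k + 1 : ℕ) : ℤ) < 0 := by
  induction k with
  | zero =>
    rw [ghat_succ β hβ1 hβ2]
    have := ghat_zero_pos β hβ1
    apply div_neg_of_neg_of_pos
    · apply mul_neg_of_pos_of_neg
      · simpa using this
      · simp; linarith
    · simp; linarith
  | succ k ih =>
    rw [ghat_succ β hβ1 hβ2]
    have hk : (0 : ℝ) ≤ k := Nat.cast_nonneg k
    apply div_neg_of_neg_of_pos
    · apply mul_neg_of_neg_of_pos ih
      push_cast; linarith
    · push_cast; linarith

lemma ghat_sum (β : ℝ) (hβ1 : 1 < β) (hβ2 : β < 2) (n : ℕ) :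
    ghat β 0 + 2 * ∑ k ∈ Finset.range n, ghat β ((k + 1 : ℕ) : ℤ)
      = - (n + 1 + β / 2) / (β / 2) * ghat β ((n + 1 : ℕ) : ℤ) := by
  induction n with
  | zero =>
    rw [ghat_succ β hβ1 hβ2]
    have : (1 + β / 2) ≠ 0 := by positivity
    simp
    field_simp
    ring
  | succ n ih =>
    rw [Finset.sum_range_succ, mul_add, ← add_assoc, ih, ghat_succ β hβ1 hβ2 (n + 1)]
    have : ((n + 1 : ℕ) : ℝ) + 1 + β / 2 ≠ 0 := by positivity
    have h2 : β ≠ 0 := by positivity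
    generalize ghat β ((n + 1 : ℕ) : ℤ) = g
    push_cast at *
    field_simp
    ring

lemma ghat_sum_pos (β : ℝ) (hβ1 : 1 < β) (hβ2 : β < 2) (n : ℕ) :
    0 < ghat β 0 + 2 * ∑ k ∈ Finset.range n, ghat β ((k + 1 : ℕ) : ℤ) := by
  rw [ghat_sum β hβ1 hβ2]
  apply mul_pos_of_neg_of_neg _ (ghat_pos_neg β hβ1 hβ2 n)
  apply div_neg_of_neg_of_pos
  · have hk : (0 : ℝ) ≤ n := Nat.cast_nonneg n
    linarith
  · linarith

lemma rcol_sum (β : ℝ) (n : ℕ) :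
    ∑ k ∈ Finset.range n, rcol β (n + 2) (k + 1)
      = 2 * ∑ k ∈ Finset.range n, ghat β ((k + 1 : ℕ) : ℤ) := by
  have : ∀ k ∈ Finset.range n, rcol β (n + 2) (k + 1)
      = ghat β ((k + 1 : ℕ) : ℤ) + ghat β (((n - 1 - k) + 1 : ℕ) : ℤ) := by
    intro k hk
    rw [Finset.mem_range] at hk
    unfold rcol
    rw [if_neg (Nat.succ_ne_zero k)]
    congr 1
    rw [← ghat_neg]
    congr 1
    push_cast
    omega
  rw [Finset.sum_congr rfl this, Finset.sum_add_distrib,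
    Finset.sum_range_reflect (fun k => ghat β ((k + 1 : ℕ) : ℤ)) n]
  ring

lemma rcol_neg (β : ℝ) (hβ1 : 1 < β) (hβ2 : β < 2) (n k : ℕ) (hk : k < n) :
    rcol β (n + 2) (k + 1) < 0 := by
  unfold rcol
  rw [if_neg (Nat.succ_ne_zero k)]
  have h1 := ghat_pos_neg β hβ1 hβ2 k
  have h2 := ghat_pos_neg β hβ1 hβ2 (n - 1 - k)
  have : (((k + 1 : ℕ) : ℤ) - (((n + 2 : ℕ) : ℤ) - 1)) = - (((n - 1 - k) + 1 : ℕ) : ℤ) := by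
    push_cast; omega
  rw [this, ghat_neg]
  linarith

/-- off-diagonal part -/
noncomputable def offv (β : ℝ) (n : ℕ) (k : Fin (n + 1)) : ℝ :=
  if k = 0 then 0 else rcol β (n + 2) k

lemma offv_sum (β : ℝ) (hβ1 : 1 < β) (hβ2 : β < 2) (n : ℕ) :
    ∑ k, |offv β n k| < ghat β 0 := by
  rw [Fin.sum_univ_succ]
  have h0 : offv β n 0 = 0 := by simp [offv]
  have h1 : ∀ k : Fin n, |offv β n k.succ| = - rcol β (n + 2) (k + 1) := by
    intro k
    have : offv β n k.succ = rcol β (n + 2) (k + 1) := by simp [offv, Fin.succ_ne_zero]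
    rw [this, abs_of_neg (rcol_neg β hβ1 hβ2 n k k.2)]
  simp only [h0, h1, abs_zero, zero_add, Finset.sum_neg_distrib]
  rw [Fin.sum_univ_eq_sum_range (fun k => rcol β (n + 2) (k + 1)) n, rcol_sum]
  have := ghat_sum_pos β hβ1 hβ2 n
  linarith

lemma fin_sub_val (n : ℕ) (i j : Fin (n + 1)) :
    (((i : ℤ) - (j : ℤ)) % (((n + 2 : ℕ) : ℤ) - 1)).toNat = ((i - j : Fin (n + 1)) : ℕ) := by
  have e : (((n + 2 : ℕ) : ℤ) - 1) = ((n + 1 : ℕ) : ℤ) := by push_cast; ring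
  rw [e]
  have hi := i.2
  have hj := j.2
  rcases le_or_gt j i with h | h
  · rw [Fin.sub_val_of_le h]
    have h' : (j : ℕ) ≤ i := h
    rw [Int.emod_eq_of_lt] <;> omega
  · have h' : (i : ℕ) < j := h
    rw [Fin.coe_sub_iff_lt.2 h, ← Int.add_emod_right, Int.emod_eq_of_lt] <;> push_cast <;> omega

/-- `circG` with its index type normalised. -/
noncomputable def circN (β : ℝ) (n : ℕ) : Matrix (Fin (n + 1)) (Fin (n + 1)) ℝ :=
  circG β (n + 2)

lemma circG_eq (β : ℝ) (n : ℕ) :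
    circN β n
      = ghat β 0 • (1 : Matrix (Fin (n + 1)) (Fin (n + 1)) ℝ) + Matrix.circulant (offv β n) := by
  ext i j
  change rcol β (n + 2) ((((i : ℤ) - (j : ℤ)) % (((n + 2 : ℕ) : ℤ) - 1)).toNat) = _
  rw [fin_sub_val]
  simp only [Matrix.add_apply, Matrix.smul_apply, Matrix.circulant_apply, smul_eq_mul, offv]
  by_cases h : i = j
  · subst h; simp [rcol]
  · have : i - j ≠ 0 := sub_ne_zero.2 h
    simp [h, this]

lemma offv_neg (β : ℝ) (n : ℕ) (k : Fin (n + 1)) : offv β n (-k) = offv β n k := by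
  by_cases h : k = 0
  · simp [h]
  · have h' : -k ≠ 0 := neg_ne_zero.2 h
    have hk : (k : ℕ) ≠ 0 := fun h2 => h (Fin.ext h2)
    have hv : ((-k : Fin (n + 1)) : ℕ) = n + 1 - k := by
      rw [Fin.val_neg]; simp [h]
    have hlt := k.2
    simp only [offv, h, h', if_false, rcol, hv, hk]
    rw [if_neg (by omega), add_comm]
    congr 1
    · rw [← ghat_neg]; congr 1; push_cast; omega
    · rw [← ghat_neg]; congr 1; push_cast; omega

lemma schur_test {ι : Type*} [Fintype ι] (C : Matrix ι ι ℝ) (s : ℝ) (hs : 0 ≤ s)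
    (hr : ∀ i, ∑ j, |C i j| ≤ s) (hc : ∀ j, ∑ i, |C i j| ≤ s) (x : ι → ℝ) :
    ∑ i, (C.mulVec x i) ^ 2 ≤ s ^ 2 * ∑ i, x i ^ 2 := by
  calc ∑ i, (C.mulVec x i) ^ 2
      ≤ ∑ i, s * ∑ j, |C i j| * x j ^ 2 := by
        apply Finset.sum_le_sum
        intro i _
        calc (C.mulVec x i) ^ 2 ≤ (∑ j, |C i j|) * ∑ j, |C i j| * x j ^ 2 := by
              apply Finset.sum_sq_le_sum_mul_sum_of_sq_le_mul
              · intros; positivity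
              · intros; positivity
              · intro j _
                apply le_of_eq; rw [mul_pow, ← sq_abs (C i j)]; ring
          _ ≤ _ := by
              apply mul_le_mul_of_nonneg_right (hr i)
              exact Finset.sum_nonneg fun j _ => by positivity
    _ = s * ∑ j, (∑ i, |C i j|) * x j ^ 2 := by
        rw [← Finset.mul_sum, Finset.sum_comm]
        simp only [Finset.sum_mul]
    _ ≤ s * ∑ j, s * x j ^ 2 := by
        apply mul_le_mul_of_nonneg_left _ hs
        apply Finset.sum_le_sum
        intro j _
        exact mul_le_mul_of_nonneg_right (hc j) (sq_nonneg _)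
    _ = _ := by rw [← Finset.mul_sum]; ring

lemma schur_norm {ι : Type*} [Fintype ι] [DecidableEq ι] (C : Matrix ι ι ℝ) (s : ℝ) (hs : 0 ≤ s)
    (hr : ∀ i, ∑ j, |C i j| ≤ s) (hc : ∀ j, ∑ i, |C i j| ≤ s) :
    ‖Matrix.toEuclideanCLM (𝕜 := ℝ) C‖ ≤ s := by
  refine ContinuousLinearMap.opNorm_le_bound _ hs fun x => ?_
  refine (sq_le_sq₀ (norm_nonneg _) (by positivity)).1 ?_
  rw [mul_pow, EuclideanSpace.real_norm_sq_eq, EuclideanSpace.real_norm_sq_eq]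
  exact schur_test C s hs hr hc x.ofLp

lemma general {ι : Type*} [Fintype ι] [DecidableEq ι] (C : Matrix ι ι ℝ) (hC : C.IsSymm)
    (s d : ℝ) (hs : 0 ≤ s) (hr : ∀ i, ∑ j, |C i j| ≤ s) (μ L : ℝ) (hμ : 0 < μ)
    (h1 : μ < d - s) (h2 : d + s < L) :
    let R : Matrix ι ι ℝ := d • (1 : Matrix ι ι ℝ) + C
    R.IsSymm ∧ R.PosDef ∧
    (∀ (lam : ℝ) (v : ι → ℝ), v ≠ 0 → R.mulVec v = lam • v → μ < lam ∧ lam < L) ∧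
    ‖Matrix.toEuclideanCLM (𝕜 := ℝ) R⁻¹‖ < 1 / μ ∧
    ‖Matrix.toEuclideanCLM (𝕜 := ℝ) R‖ < L := by
  intro R
  have hc : ∀ j, ∑ i, |C i j| ≤ s := fun j => by
    simpa only [hC.apply] using hr j
  have hn := schur_norm C s hs hr hc
  have hd : 0 ≤ d := by linarith
  have hsymm : R.IsSymm := by
    unfold Matrix.IsSymm
    simp only [R, Matrix.transpose_add, Matrix.transpose_smul, Matrix.transpose_one, hC.eq]
  have hRT : Matrix.toEuclideanCLM (𝕜 := ℝ) R
      = d • (1 : EuclideanSpace ℝ ι →L[ℝ] EuclideanSpace ℝ ι)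
        + Matrix.toEuclideanCLM (𝕜 := ℝ) C := by
    simp only [R, map_add, map_smul, map_one]
  have hCx : ∀ x : EuclideanSpace ℝ ι, ‖Matrix.toEuclideanCLM (𝕜 := ℝ) C x‖ ≤ s * ‖x‖ :=
    fun x => (Matrix.toEuclideanCLM (𝕜 := ℝ) C).le_of_opNorm_le hn x
  have hlow : ∀ x : EuclideanSpace ℝ ι,
      (d - s) * ‖x‖ ≤ ‖Matrix.toEuclideanCLM (𝕜 := ℝ) R x‖ := by
    intro x
    have e : d • x = Matrix.toEuclideanCLM (𝕜 := ℝ) R x - Matrix.toEuclideanCLM (𝕜 := ℝ) C x := by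
      rw [hRT]; simp
    have h3 := norm_sub_le (Matrix.toEuclideanCLM (𝕜 := ℝ) R x) (Matrix.toEuclideanCLM (𝕜 := ℝ) C x)
    rw [← e, norm_smul, Real.norm_of_nonneg hd] at h3
    have := hCx x
    linarith
  have hpos : R.PosDef := by
    refine Matrix.PosDef.of_dotProduct_mulVec_pos ?_ ?_
    · unfold Matrix.IsHermitian
      rw [Matrix.conjTranspose_eq_transpose_of_trivial]; exact hsymm
    · intro x hx
      have hx' : 0 < ‖WithLp.toLp 2 x‖ := by
        rw [norm_pos_iff]; intro h; apply hx
        simpa using h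
      have e1 : star x ⬝ᵥ R.mulVec x = d * ‖WithLp.toLp 2 x‖ ^ 2
          + inner ℝ (WithLp.toLp 2 x) (Matrix.toEuclideanCLM (𝕜 := ℝ) C (WithLp.toLp 2 x)) := by
        rw [EuclideanSpace.real_norm_sq_eq]
        simp only [R, Matrix.add_mulVec, Matrix.smul_mulVec, Matrix.one_mulVec, dotProduct_add,
          dotProduct_smul, smul_eq_mul, star_trivial]
        congr 1
        · simp [dotProduct, pow_two]
        · simp [PiLp.inner_apply, dotProduct, mul_comm]
      have h4 := abs_real_inner_le_norm (WithLp.toLp 2 x)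
        (Matrix.toEuclideanCLM (𝕜 := ℝ) C (WithLp.toLp 2 x))
      have h5 := mul_le_mul_of_nonneg_left (hCx (WithLp.toLp 2 x)) hx'.le
      have h6 := neg_abs_le (inner ℝ (WithLp.toLp 2 x)
        (Matrix.toEuclideanCLM (𝕜 := ℝ) C (WithLp.toLp 2 x)))
      rw [e1]
      have h7 : 0 < (d - s) * ‖WithLp.toLp 2 x‖ ^ 2 := by
        apply mul_pos (by linarith) (by positivity)
      nlinarith
  refine ⟨hsymm, hpos, ?_, ?_, ?_⟩
  · intro lam v hv hev
    have hx' : 0 < ‖WithLp.toLp 2 v‖ := by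
      rw [norm_pos_iff]; intro h; apply hv
      simpa using h
    have e : Matrix.toEuclideanCLM (𝕜 := ℝ) C (WithLp.toLp 2 v) = (lam - d) • WithLp.toLp 2 v := by
      have : Matrix.toEuclideanCLM (𝕜 := ℝ) R (WithLp.toLp 2 v) = lam • WithLp.toLp 2 v := by
        rw [Matrix.toEuclideanCLM_toLp, hev]; rfl
      rw [hRT] at this
      rw [sub_smul, ← this]; simp
    have h3 := hCx (WithLp.toLp 2 v)
    rw [e, norm_smul, Real.norm_eq_abs] at h3
    have h4 := le_of_mul_le_mul_right h3 hx'
    rw [abs_le] at h4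
    constructor <;> linarith
  · have hu : IsUnit R.det := (Matrix.isUnit_iff_isUnit_det _).1 hpos.isUnit
    have hds : 0 < d - s := by linarith
    have : ‖Matrix.toEuclideanCLM (𝕜 := ℝ) R⁻¹‖ ≤ 1 / (d - s) := by
      refine ContinuousLinearMap.opNorm_le_bound _ (by positivity) fun x => ?_
      have h3 := hlow (Matrix.toEuclideanCLM (𝕜 := ℝ) R⁻¹ x)
      have e : Matrix.toEuclideanCLM (𝕜 := ℝ) R (Matrix.toEuclideanCLM (𝕜 := ℝ) R⁻¹ x) = x := by
        rw [← ContinuousLinearMap.mul_apply, ← map_mul, Matrix.mul_nonsing_inv _ hu, map_one]; rfl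
      rw [e] at h3
      rw [one_div, inv_mul_eq_div, le_div_iff₀ hds]
      linarith
    exact this.trans_lt (one_div_lt_one_div_of_lt hμ h1)
  · refine lt_of_le_of_lt ?_ h2
    refine ContinuousLinearMap.opNorm_le_bound _ (by linarith) fun x => ?_
    have e : Matrix.toEuclideanCLM (𝕜 := ℝ) R x = d • x + Matrix.toEuclideanCLM (𝕜 := ℝ) C x := by
      rw [hRT]; simp
    rw [e]
    have h3 := norm_add_le (d • x) (Matrix.toEuclideanCLM (𝕜 := ℝ) C x)
    rw [norm_smul, Real.norm_of_nonneg hd] at h3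
    have := hCx x
    linarith

/-- the circulant preconditioner `R = μ₀ I + K ν_β r(G_β)` is symmetric
positive definite, its eigenvalues lie in `(μ₀, μ₀ + 2 K ν_β ĝ₀^{(β)})`, and its spectral
norms satisfy `‖R⁻¹‖₂ < 1/μ₀` and `‖R‖₂ < μ₀ + 2 K ν_β ĝ₀^{(β)}`. -/
theorem stmt4 (β : ℝ) (hβ1 : 1 < β) (hβ2 : β < 2) (M : ℕ) (hM : 2 ≤ M)
    (μ₀ K νβ : ℝ) (hμ : 0 < μ₀) (hK : 0 < K) (hν : 0 < νβ) :
    let R : Matrix (Fin (M - 1)) (Fin (M - 1)) ℝ :=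
      μ₀ • (1 : Matrix (Fin (M - 1)) (Fin (M - 1)) ℝ) + (K * νβ) • circG β M
    R.IsSymm ∧ R.PosDef ∧
    (∀ (lam : ℝ) (v : Fin (M - 1) → ℝ), v ≠ 0 → R.mulVec v = lam • v →
      μ₀ < lam ∧ lam < μ₀ + 2 * K * νβ * ghat β 0) ∧
    ‖Matrix.toEuclideanCLM (𝕜 := ℝ) R⁻¹‖ < 1 / μ₀ ∧
    ‖Matrix.toEuclideanCLM (𝕜 := ℝ) R‖ < μ₀ + 2 * K * νβ * ghat β 0 := by
  obtain ⟨n, rfl⟩ : ∃ n, M = n + 2 := ⟨M - 2, by omega⟩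
  have hκ : 0 < K * νβ := mul_pos hK hν
  have hs := offv_sum β hβ1 hβ2 n
  have hs0 : 0 ≤ ∑ k, |offv β n k| := Finset.sum_nonneg fun _ _ => abs_nonneg _
  have key := general ((K * νβ) • Matrix.circulant (offv β n)) (by
      apply Matrix.IsSymm.smul
      rw [Matrix.circulant_isSymm_iff]
      exact offv_neg β n)
    (K * νβ * ∑ k, |offv β n k|) (μ₀ + K * νβ * ghat β 0) (by positivity) (by
      intro i
      apply le_of_eq
      simp only [Matrix.smul_apply, Matrix.circulant_apply, smul_eq_mul, abs_mul (K * νβ),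
        abs_of_pos hκ, ← Finset.mul_sum]
      congr 1
      exact Equiv.sum_comp (Equiv.subLeft i) (fun k => |offv β n k|))
    μ₀ (μ₀ + 2 * K * νβ * ghat β 0) hμ (by nlinarith) (by nlinarith)
  have e : (μ₀ + K * νβ * ghat β 0) • (1 : Matrix (Fin (n + 1)) (Fin (n + 1)) ℝ)
      + (K * νβ) • Matrix.circulant (offv β n)
      = μ₀ • (1 : Matrix (Fin (n + 1)) (Fin (n + 1)) ℝ)
        + (K * νβ) • circN β n := by
    rw [circG_eq, smul_add, smul_smul, add_smul, add_assoc]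
  rw [e] at key
  exact key
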